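/- (Equations (2.21) and (2.22)) The *-Ricci tensor ρ̄* of the cone, defined by ρ̄*(X̄,Ȳ) = (1/2)Σ_α R̄(X̄, J̄Ȳ, J̄ē_α, ē_α) over an orthonormal basis (ē_α) of V̄, satisfies: ρ̄*((Y,0),(Z,0)) = ρ*(Y,Z) − g(Y,Z) + η(Y)η(Z) for all Y,Z ∈ V; ρ̄*((Y,0),(0,1)) = (1/2)Σ_a R(Y,ξ,φe_a,e_a) for all Y ∈ V; ρ̄*((0,1),Ȳ) = 0 for all Ȳ ∈ V̄; and the *-scalar curvature τ̄* = Σ_α ρ̄*(ē_α,ē_α) satisfies τ̄* = τ* − 2n, where ρ*(X,Y) = (1/2)Σ_a R(X,φY,φe_a,e_a) and τ* = Σ_a ρ*(e_a,e_a) over an orthonormal basis (e_a) of V. -/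

import Mathlib

open scoped RealInnerProductSpace

/-- The almost complex structure `J̄` of the algebraic cone `V × ℝ` over an almost
contact metric structure `(φ, ξ)`: `J̄(X, s) = (φX + sξ, −η(X))`. -/
noncomputable def Jbar {V : Type*} [NormedAddCommGroup V] [InnerProductSpace ℝ V]
    (φ : V →ₗ[ℝ] V) (ξ : V) : V × ℝ → V × ℝ :=
  fun p => (φ p.1 + p.2 • ξ, -⟪ξ, p.1⟫)

/-- The curvature-like tensor `R̄` of the algebraic cone `V × ℝ`:
`R̄(X̄,Ȳ,Z̄,W̄) = R(X,Y,Z,W) − g(X,W)g(Y,Z) + g(Y,W)g(X,Z)`. -/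
noncomputable def Rbar {V : Type*} [NormedAddCommGroup V] [InnerProductSpace ℝ V]
    (R : V →ₗ[ℝ] V →ₗ[ℝ] V →ₗ[ℝ] V →ₗ[ℝ] ℝ) :
    V × ℝ → V × ℝ → V × ℝ → V × ℝ → ℝ :=
  fun X Y Z W =>
    R X.1 Y.1 Z.1 W.1 - ⟪X.1, W.1⟫ * ⟪Y.1, Z.1⟫ + ⟪Y.1, W.1⟫ * ⟪X.1, Z.1⟫

/-- The `*`-Ricci tensor of `R` with respect to the orthonormal basis `e`:
`ρ*(X,Y) = (1/2) Σ_a R(X, φY, φe_a, e_a)`. -/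
noncomputable def starRicci {V : Type*} [NormedAddCommGroup V] [InnerProductSpace ℝ V] {m : ℕ}
    (φ : V →ₗ[ℝ] V) (R : V →ₗ[ℝ] V →ₗ[ℝ] V →ₗ[ℝ] V →ₗ[ℝ] ℝ)
    (e : OrthonormalBasis (Fin m) ℝ V) : V → V → ℝ :=
  fun X Y => (1 / 2 : ℝ) * ∑ a, R X (φ Y) (φ (e a)) (e a)

/-- The `*`-Ricci tensor of the cone curvature tensor `R̄`:
`ρ̄*(X̄,Ȳ) = (1/2) Σ_α R̄(X̄, J̄Ȳ, J̄ē_α, ē_α)`, computed with the orthonormal basis of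
`V × ℝ` consisting of the `(e a, 0)` together with `(0, 1)`. -/
noncomputable def starRicciBar {V : Type*} [NormedAddCommGroup V] [InnerProductSpace ℝ V] {m : ℕ}
    (φ : V →ₗ[ℝ] V) (ξ : V) (R : V →ₗ[ℝ] V →ₗ[ℝ] V →ₗ[ℝ] V →ₗ[ℝ] ℝ)
    (e : OrthonormalBasis (Fin m) ℝ V) : V × ℝ → V × ℝ → ℝ :=
  fun Xb Yb => (1 / 2 : ℝ) *
    ((∑ a, Rbar R Xb (Jbar φ ξ Yb) (Jbar φ ξ (e a, (0 : ℝ))) (e a, (0 : ℝ)))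
      + Rbar R Xb (Jbar φ ξ Yb) (Jbar φ ξ ((0 : V), (1 : ℝ))) ((0 : V), (1 : ℝ)))

/-- The structure tensor of an almost contact metric structure is skew-adjoint. -/
theorem inner_phi_left_eq_neg {V : Type*} [NormedAddCommGroup V] [InnerProductSpace ℝ V]
    {φ : V →ₗ[ℝ] V} {ξ : V}
    (hφφ : ∀ X : V, φ (φ X) = -X + ⟪ξ, X⟫ • ξ) (hηφ : ∀ X : V, ⟪ξ, φ X⟫ = 0)
    (hg : ∀ X Y : V, ⟪φ X, φ Y⟫ = ⟪X, Y⟫ - ⟪ξ, X⟫ * ⟪ξ, Y⟫) (X Y : V) :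
    ⟪φ X, Y⟫ = -⟪X, φ Y⟫ := by
  have h := hg X (φ Y)
  rw [hφφ, inner_add_right, inner_neg_right, inner_smul_right, real_inner_comm ξ (φ X),
    hηφ, hηφ] at h
  linarith

/-- For skew-adjoint `φ`, the `*`-Ricci tensor of the cone is the contraction of `R` corrected by
the metric term `⟪X, φ U⟫`, where `U` is the horizontal part of `J̄Ȳ`. -/
theorem starRicciBar_eq {V : Type*} [NormedAddCommGroup V] [InnerProductSpace ℝ V] {m : ℕ}
    {φ : V →ₗ[ℝ] V} (hskew : ∀ X Y : V, ⟪φ X, Y⟫ = -⟪X, φ Y⟫) (ξ : V)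
    (R : V →ₗ[ℝ] V →ₗ[ℝ] V →ₗ[ℝ] V →ₗ[ℝ] ℝ) (e : OrthonormalBasis (Fin m) ℝ V)
    (Xb Yb : V × ℝ) :
    starRicciBar φ ξ R e Xb Yb =
      (1 / 2 : ℝ) * ∑ a, R Xb.1 (φ Yb.1 + Yb.2 • ξ) (φ (e a)) (e a)
        + ⟪Xb.1, φ (φ Yb.1 + Yb.2 • ξ)⟫ := by
  obtain ⟨X, r⟩ := Xb
  obtain ⟨Y, s⟩ := Yb
  simp only [starRicciBar, Rbar, Jbar, inner_zero_right, map_zero, zero_mul, zero_smul, add_zero,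
    sub_zero, Finset.sum_add_distrib, Finset.sum_sub_distrib]
  generalize φ Y + s • ξ = U
  have hcontract (A B : V) : ∑ a, ⟪A, e a⟫ * ⟪B, φ (e a)⟫ = -⟪A, φ B⟫ := by
    rw [← e.sum_inner_mul_inner A (φ B), ← Finset.sum_neg_distrib]
    refine Finset.sum_congr rfl fun a _ => ?_
    rw [real_inner_comm (φ B) (e a), hskew B (e a)]
    ring
  rw [hcontract X U, hcontract U X, real_inner_comm (φ X) U, hskew X U]
  ring

theorem cone_star_ricci_and_star_scalar_curvature
    {V : Type*} [NormedAddCommGroup V] [InnerProductSpace ℝ V] [FiniteDimensional ℝ V]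
    (n : ℕ) (hn : 1 ≤ n) (hdim : Module.finrank ℝ V = 2 * n + 1)
    (φ : V →ₗ[ℝ] V) (ξ : V)
    (hφφ : ∀ X : V, φ (φ X) = -X + ⟪ξ, X⟫ • ξ)
    (hφξ : φ ξ = 0)
    (hηφ : ∀ X : V, ⟪ξ, φ X⟫ = 0)
    (hηξ : ⟪ξ, ξ⟫ = (1 : ℝ))
    (hg : ∀ X Y : V, ⟪φ X, φ Y⟫ = ⟪X, Y⟫ - ⟪ξ, X⟫ * ⟪ξ, Y⟫)
    (R : V →ₗ[ℝ] V →ₗ[ℝ] V →ₗ[ℝ] V →ₗ[ℝ] ℝ)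
    (hskew₁ : ∀ X Y Z W : V, R X Y Z W = - R Y X Z W)
    (hskew₂ : ∀ X Y Z W : V, R X Y Z W = - R X Y W Z)
    (hsymm : ∀ X Y Z W : V, R X Y Z W = R Z W X Y)
    (hbianchi : ∀ X Y Z W : V, R X Y Z W + R Y Z X W + R Z X Y W = 0)
    (e : OrthonormalBasis (Fin (2 * n + 1)) ℝ V)
    :
    (∀ Y Z : V, starRicciBar φ ξ R e (Y, (0 : ℝ)) (Z, (0 : ℝ))
      = starRicci φ R e Y Z - ⟪Y, Z⟫ + ⟪ξ, Y⟫ * ⟪ξ, Z⟫)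
    ∧ (∀ Y : V, starRicciBar φ ξ R e (Y, (0 : ℝ)) ((0 : V), (1 : ℝ))
      = (1 / 2 : ℝ) * ∑ a, R Y ξ (φ (e a)) (e a))
    ∧ (∀ Yb : V × ℝ, starRicciBar φ ξ R e ((0 : V), (1 : ℝ)) Yb = 0)
    ∧ (∑ a, starRicciBar φ ξ R e (e a, (0 : ℝ)) (e a, (0 : ℝ)))
        + starRicciBar φ ξ R e ((0 : V), (1 : ℝ)) ((0 : V), (1 : ℝ))
      = (∑ a, starRicci φ R e (e a) (e a)) - 2 * (n : ℝ) := by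
  have hbar := starRicciBar_eq (inner_phi_left_eq_neg hφφ hηφ hg) ξ R e
  have hhor (Y Z : V) : starRicciBar φ ξ R e (Y, (0 : ℝ)) (Z, (0 : ℝ))
      = starRicci φ R e Y Z - ⟪Y, Z⟫ + ⟪ξ, Y⟫ * ⟪ξ, Z⟫ := by
    rw [hbar, starRicci]
    simp only [zero_smul, add_zero, hφφ, inner_add_right, inner_neg_right, inner_smul_right,
      real_inner_comm ξ Y]
    ring
  have hvert (Yb : V × ℝ) : starRicciBar φ ξ R e ((0 : V), (1 : ℝ)) Yb = 0 := by
    simp [hbar]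
  refine ⟨hhor, fun Y => by simp [hbar, hφξ], hvert, ?_⟩
  have hη : ∑ a, ⟪ξ, e a⟫ * ⟪ξ, e a⟫ = 1 := by
    rw [← hηξ, ← e.sum_inner_mul_inner ξ ξ]
    exact Finset.sum_congr rfl fun a _ => by rw [real_inner_comm ξ (e a)]
  simp only [hhor, hvert, Finset.sum_add_distrib, Finset.sum_sub_distrib, hη, e.inner_eq_one,
    Finset.sum_const, Finset.card_univ, Fintype.card_fin, nsmul_eq_mul]
  push_cast
  ring
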